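/- Let p ≥ 3 be an integer, let f = (f_{i,j}) be an infinite frieze pattern of type Λ_p, and let b ∈ ℤ. Let N(b) = |{j ∈ ℤ : j ≤ b−2, f_{j,b} = 1}| + |{j ∈ ℤ : j ≥ b+2, f_{b,j} = 1}| (a finite number). Then f_{b−1,b+1} ≥ λ_p·(1 + N(b)); in other words the defect def(b) = f_{b−1,b+1} − λ_p·(1 + N(b)) is a nonnegative integer multiple of λ_p. -/

import Mathlib

/-- `lam p = λ_p = 2 cos (π / p)`. -/
noncomputable def lam (p : ℕ) : ℝ := 2 * Real.cos (Real.pi / p)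

/-- An infinite frieze pattern. -/
def IsInfFrieze (f : ℤ → ℤ → ℝ) : Prop :=
  (∀ i : ℤ, f i i = 0) ∧
  (∀ i : ℤ, f i (i + 1) = 1) ∧
  (∀ i j : ℤ, i + 1 ≤ j → 0 < f i j) ∧
  (∀ i j : ℤ, i + 1 ≤ j → f i j * f (i + 1) (j + 1) - f i (j + 1) * f (i + 1) j = 1)

/-- The frieze pattern is of type `Λ_p`. -/
def IsTypeLambda (p : ℕ) (f : ℤ → ℤ → ℝ) : Prop :=
  ∀ i : ℤ, ∃ n : ℕ, 0 < n ∧ f i (i + 2) = n * lam p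

/-- `N f b` = number of arcs of `Θ(F)` attached to `b`. -/
noncomputable def numArcs (f : ℤ → ℤ → ℝ) (b : ℤ) : ℕ :=
  ({j : ℤ | j ≤ b - 2 ∧ f j b = 1}).ncard + ({j : ℤ | b + 2 ≤ j ∧ f b j = 1}).ncard

/-- The Chebyshev-like numbers `sin (k π / p) / sin (π / p)`. -/
noncomputable def chS (p k : ℕ) : ℝ := Real.sin (k * (Real.pi / p)) / Real.sin (Real.pi / p)

section sqfacts
variable {p : ℕ}

lemma sin_base_pos (hp : 3 ≤ p) : 0 < Real.sin (Real.pi / p) := by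
  have h3 : (3 : ℝ) ≤ p := by exact_mod_cast hp
  apply Real.sin_pos_of_pos_of_lt_pi
  · have := Real.pi_pos
    positivity
  · exact div_lt_self Real.pi_pos (by linarith)

lemma chS_zero : chS p 0 = 0 := by simp [chS]

lemma chS_one (hp : 3 ≤ p) : chS p 1 = 1 := by
  have := sin_base_pos hp
  simp [chS, this.ne']

lemma chS_rec (k : ℕ) : chS p (k + 2) = lam p * chS p (k + 1) - chS p k := by
  unfold chS lam
  have h : Real.sin (((k + 2 : ℕ) : ℝ) * (Real.pi / p)) =
      2 * Real.cos (Real.pi / p) * Real.sin (((k + 1 : ℕ) : ℝ) * (Real.pi / p))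
        - Real.sin ((k : ℝ) * (Real.pi / p)) := by
    have e1 : ((k + 2 : ℕ) : ℝ) * (Real.pi / p)
        = ((k + 1 : ℕ) : ℝ) * (Real.pi / p) + Real.pi / p := by push_cast; ring
    have e2 : (k : ℝ) * (Real.pi / p)
        = ((k + 1 : ℕ) : ℝ) * (Real.pi / p) - Real.pi / p := by push_cast; ring
    rw [e1, e2, Real.sin_add, Real.sin_sub]
    ring
  rw [h]
  ring

lemma chS_symm (hp : 3 ≤ p) {k l : ℕ} (h : k + l = p) : chS p k = chS p l := by
  have h0 : (p : ℝ) ≠ 0 := by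
    have : p ≠ 0 := by omega
    exact_mod_cast this
  unfold chS
  have : (k : ℝ) * (Real.pi / p) = Real.pi - l * (Real.pi / p) := by
    have : (k : ℝ) = p - l := by rw [← h]; push_cast; ring
    rw [this]
    field_simp
  rw [this, Real.sin_pi_sub]

lemma chS_gt (hp : 3 ≤ p) {k : ℕ} (h1 : 2 ≤ k) (h2 : k + 2 ≤ p) : 1 < chS p k := by
  have hs := sin_base_pos hp
  have hp0 : (0 : ℝ) < p := by
    have : 0 < p := by omega
    exact_mod_cast this
  unfold chS
  rw [lt_div_iff₀ hs, one_mul]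
  have hk1 : (2 : ℝ) ≤ k := by exact_mod_cast h1
  have hk2 : (k : ℝ) + 2 ≤ p := by exact_mod_cast h2
  have hpi := Real.pi_pos
  set t := Real.pi / p with ht
  have ht0 : 0 < t := by positivity
  have htp : p * t = Real.pi := by rw [ht]; field_simp
  have hd := Real.sin_sub_sin (k * t) t
  have c1 : 0 < Real.sin ((k * t - t) / 2) := by
    apply Real.sin_pos_of_pos_of_lt_pi <;> nlinarith
  have c2 : 0 < Real.cos ((k * t + t) / 2) := by
    apply Real.cos_pos_of_mem_Ioo
    constructor <;> nlinarith
  have : 0 < Real.sin (k * t) - Real.sin t := by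
    rw [hd]; positivity
  linarith

lemma chS_ge (hp : 3 ≤ p) {k : ℕ} (h1 : 1 ≤ k) (h2 : k + 1 ≤ p) : 1 ≤ chS p k := by
  rcases Nat.lt_or_ge 1 k with h | h
  · rcases Nat.lt_or_ge (k + 1) p with h' | h'
    · exact (chS_gt hp h h').le
    · rw [chS_symm hp (show k + 1 = p by omega), chS_one hp]
  · have : k = 1 := by omega
    subst this
    rw [chS_one hp]

lemma chS_nonneg' (hp : 3 ≤ p) {k : ℕ} (h2 : k ≤ p) : 0 ≤ chS p k := by
  rcases Nat.eq_zero_or_pos k with h | h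
  · subst h; rw [chS_zero]
  · rcases Nat.lt_or_ge k p with h' | h'
    · linarith [chS_ge hp h h']
    · rw [chS_symm hp (show k + 0 = p by omega), chS_zero]

lemma chS_two (hp : 3 ≤ p) : chS p 2 = lam p := by
  have := chS_rec (p := p) 0
  simp only [zero_add, chS_zero, chS_one hp] at this
  rw [this]; ring

lemma lam_ge (hp : 3 ≤ p) : 1 ≤ lam p := by
  rw [← chS_two hp]; exact chS_ge hp (by norm_num) hp

end sqfacts

/-- Vectors of the Hecke orbit of `(1, 0)` that lie in the closed first quadrant. -/
inductive HW (p : ℕ) : ℝ → ℝ → Prop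
  | e0 : HW p 1 0
  | e1 : HW p 0 1
  | step (k : ℕ) (hk : k + 2 ≤ p) (a b : ℝ) (h : HW p a b) :
      HW p (a * chS p (k + 1) + b * chS p (k + 2)) (a * chS p k + b * chS p (k + 1))

section HWfacts
variable {p : ℕ}

lemma HW.swap (hp : 3 ≤ p) {x y : ℝ} (h : HW p x y) : HW p y x := by
  induction h with
  | e0 => exact HW.e1
  | e1 => exact HW.e0
  | step k hk a b h ih =>
    have := HW.step (p - k - 2) (by omega) b a ih
    rw [chS_symm hp (show p - k - 2 + 1 + (k + 1) = p by omega),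
      chS_symm hp (show p - k - 2 + 2 + k = p by omega),
      chS_symm hp (show p - k - 2 + (k + 2) = p by omega)] at this
    convert this using 1 <;> ring

lemma HW.facts (hp : 3 ≤ p) {x y : ℝ} (h : HW p x y) :
    (x = 0 ∨ 1 ≤ x) ∧ (y = 0 ∨ 1 ≤ y) ∧ (y = 0 → x = 1) := by
  induction h with
  | e0 => norm_num
  | e1 => norm_num
  | step k hk a b h ih =>
    obtain ⟨ha, hb, hab⟩ := ih
    have ha0 : 0 ≤ a := by rcases ha with h | h <;> linarith
    have hb0 : 0 ≤ b := by rcases hb with h | h <;> linarith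
    have key : ∀ u s : ℝ, (u = 0 ∨ 1 ≤ u) → (s = 0 ∨ 1 ≤ s) → (u * s = 0 ∨ 1 ≤ u * s) := by
      intro u s hu hs
      rcases hu with hu | hu
      · left; simp [hu]
      · rcases hs with hs | hs
        · left; simp [hs]
        · right; nlinarith
    have key2 : ∀ u s : ℝ, (u = 0 ∨ 1 ≤ u) → (s = 0 ∨ 1 ≤ s) → (u + s = 0 ∨ 1 ≤ u + s) := by
      intro u s hu hs
      rcases hu with hu | hu <;> rcases hs with hs | hs
      · left; linarith
      all_goals right; linarith
    have sd : ∀ j ≤ p, chS p j = 0 ∨ 1 ≤ chS p j := by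
      intro j hj
      rcases Nat.eq_zero_or_pos j with h | h
      · left; subst h; exact chS_zero
      · rcases Nat.lt_or_ge j p with h' | h'
        · right; exact chS_ge hp h h'
        · left; rw [chS_symm hp (show j + 0 = p by omega), chS_zero]
    refine ⟨key2 _ _ (key _ _ ha (sd _ (by omega))) (key _ _ hb (sd _ (by omega))),
      key2 _ _ (key _ _ ha (sd _ (by omega))) (key _ _ hb (sd _ (by omega))), ?_⟩
    intro h0
    have s1 := chS_ge hp (show 1 ≤ k + 1 by omega) (by omega)
    have s0 := chS_nonneg' hp (show k ≤ p by omega)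
    have hbz : b = 0 := by nlinarith [mul_nonneg ha0 s0]
    have ha1 := hab hbz
    subst hbz ha1
    have hsk : chS p k = 0 := by linarith
    have hk0 : k = 0 := by
      by_contra hne
      have := chS_ge hp (show 1 ≤ k by omega) (by omega)
      linarith
    subst hk0
    simp [chS_one hp]

lemma HW.nonneg (hp : 3 ≤ p) {x y : ℝ} (h : HW p x y) : 0 ≤ x ∧ 0 ≤ y := by
  obtain ⟨h1, h2, -⟩ := h.facts hp
  constructor
  · rcases h1 with h | h <;> linarith
  · rcases h2 with h | h <;> linarith

lemma HW.trans_pos (hp : 3 ≤ p) {x y : ℝ} (h : HW p x y) : HW p (x + lam p * y) y := by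
  have := HW.step 0 (by omega) x y h
  simp only [zero_add, chS_zero, chS_one hp, chS_two hp] at this
  convert this using 1 <;> ring

lemma HW.trans_neg (hp : 3 ≤ p) {x y : ℝ} (h : HW p x y) (hxy : 0 ≤ x - lam p * y) :
    HW p (x - lam p * y) y := by
  have hl := lam_ge hp
  cases h with
  | e0 => simpa using HW.e0
  | e1 => exfalso; linarith
  | step k hk a b h =>
    obtain ⟨ha0, hb0⟩ := h.nonneg hp
    obtain ⟨-, -, hab⟩ := h.facts hp
    rcases k with _ | k
    · simp only [zero_add, chS_zero, chS_one hp, chS_two hp]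
      convert h using 1 <;> ring
    · have r1 := chS_rec (p := p) k
      have r2 := chS_rec (p := p) (k + 1)
      simp only [add_assoc, Nat.reduceAdd] at *
      have e : a * chS p (k + 2) + b * chS p (k + 3) - lam p * (a * chS p (k + 1) + b * chS p (k + 2))
          = - (a * chS p k + b * chS p (k + 1)) := by rw [r2, r1]; ring
      have s1 := chS_ge hp (show 1 ≤ k + 1 by omega) (by omega)
      have s0 := chS_nonneg' hp (show k ≤ p by omega)
      have hbz : b = 0 := by nlinarith [mul_nonneg ha0 s0]
      have ha1 := hab hbz
      subst hbz ha1
      have hsk : chS p k = 0 := by linarith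
      have hk0 : k = 0 := by
        by_contra hne
        have := chS_ge hp (show 1 ≤ k by omega) (by omega)
        linarith
      subst hk0
      convert HW.e1 using 1
      · rw [e, hsk]; ring
      · simp [chS_one hp]

lemma HW.reflect (hp : 3 ≤ p) {x y : ℝ} (h : HW p x y) (hxy : 0 ≤ lam p * y - x) :
    HW p (lam p * y - x) y := by
  have hl := lam_ge hp
  cases h with
  | e0 => exfalso; linarith
  | e1 =>
    have := HW.e1.trans_pos hp
    convert this using 1; ring
  | step k hk a b h =>
    obtain ⟨ha0, hb0⟩ := h.nonneg hp
    rcases k with _ | k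
    · simp only [zero_add, chS_zero, chS_one hp, chS_two hp] at *
      have haz : a = 0 := by linarith
      subst haz
      have := (h.swap hp).facts hp
      have hb1 := this.2.2 rfl
      subst hb1
      convert HW.e1 using 1 <;> ring
    · have r1 := chS_rec (p := p) k
      have r2 := chS_rec (p := p) (k + 1)
      have := HW.step (p - k - 3 + 1) (by omega) b a (h.swap hp)
      rw [chS_symm hp (show p - k - 3 + 1 + 1 + (k + 1) = p by omega),
        chS_symm hp (show p - k - 3 + 1 + 2 + k = p by omega),
        chS_symm hp (show p - k - 3 + 1 + (k + 2) = p by omega)] at this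
      simp only [add_assoc, Nat.reduceAdd] at *
      convert this using 1
      · rw [r2, r1]; ring
      · ring

lemma HW.flip (hp : 3 ≤ p) (n : ℕ) : ∀ {x y : ℝ}, HW p x y → 0 ≤ n * lam p * y - x →
    HW p (n * lam p * y - x) y := by
  induction n with
  | zero =>
    intro x y h hxy
    have := (h.nonneg hp).1
    have hx : x = 0 := by simp at hxy; linarith
    subst hx
    simpa using h
  | succ n ih =>
    intro x y h hxy
    rcases le_total 0 (lam p * y - x) with h' | h'
    · have key : ∀ m : ℕ, HW p (m * (lam p * y) + (lam p * y - x)) y := by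
        intro m
        induction m with
        | zero => simpa using h.reflect hp h'
        | succ m ihm =>
          have := ihm.trans_pos hp
          convert this using 1; push_cast; ring
      convert key n using 1; push_cast; ring
    · have h2 := h.trans_neg hp (by linarith)
      have e : ((n + 1 : ℕ) : ℝ) * lam p * y - x = n * lam p * y - (x - lam p * y) := by
        push_cast; ring
      rw [e] at hxy ⊢
      exact ih h2 hxy

lemma HW.int_mult (hp : 3 ≤ p) {x y : ℝ} (h : HW p x y) : y = 1 → ∃ m : ℤ, x = m * lam p := by
  have hl := lam_ge hp
  induction h with
  | e0 => intro h; norm_num at h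
  | e1 => intro _; exact ⟨0, by simp⟩
  | step k hk a b h ih =>
    intro h1
    obtain ⟨ha0, hb0⟩ := h.nonneg hp
    obtain ⟨ha, hb, hab⟩ := h.facts hp
    rcases Nat.eq_zero_or_pos k with h0 | h0
    · subst h0
      simp only [zero_add, chS_zero, chS_one hp, chS_two hp] at *
      obtain ⟨m, hm⟩ := ih (by linarith)
      have hb1 : b = 1 := by linarith
      subst hb1
      exact ⟨m + 1, by rw [hm]; push_cast; ring⟩
    rcases Nat.lt_or_ge (k + 2) p with h2 | h2
    · have s1 := chS_gt hp (show 2 ≤ k + 1 by omega) (by omega)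
      have s0 := chS_ge hp (show 1 ≤ k by omega) (by omega)
      have hbz : b = 0 := by
        rcases hb with hb | hb
        · exact hb
        · exfalso; nlinarith [mul_nonneg ha0 (by linarith : 0 ≤ chS p k)]
      have ha1 := hab hbz
      subst hbz ha1
      have hk1 : k = 1 := by
        by_contra hne
        have := chS_gt hp (show 2 ≤ k by omega) (by omega)
        linarith
      subst hk1
      exact ⟨1, by simp [chS_two hp]⟩
    · have hz : chS p (k + 2) = 0 := by rw [chS_symm hp (show k + 2 + 0 = p by omega), chS_zero]
      have ho : chS p (k + 1) = 1 := by
        rw [chS_symm hp (show k + 1 + 1 = p by omega), chS_one hp]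
      have ht : chS p k = lam p := by
        rw [chS_symm hp (show k + 2 = p by omega), chS_two hp]
      rw [ho, ht] at h1
      rw [hz, ho]
      rcases ha with ha | ha
      · exact ⟨0, by simp [ha]⟩
      · refine ⟨1, ?_⟩
        have : a = 1 := by nlinarith
        have : lam p = 1 := by nlinarith
        push_cast
        linarith

end HWfacts

section frieze
variable {p : ℕ} {f : ℤ → ℤ → ℝ}

lemma frieze_rec (hf : IsInfFrieze f) (i : ℤ) (j : ℤ) (hij : i + 1 ≤ j) :
    f (i - 1) j = f (i - 1) (i + 1) * f i j - f (i + 1) j := by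
  obtain ⟨h0, h1, hpos, hu⟩ := hf
  induction j, hij using Int.le_induction with
  | base => rw [h1, h0]; ring
  | succ j hj ih =>
    have a1 := hu (i - 1) j (by omega)
    have a2 := hu i j hj
    rw [sub_add_cancel] at a1
    have hp := hpos i j hj
    have : (f (i - 1) (j + 1)) * f i j
        = (f (i - 1) (i + 1) * f i (j + 1) - f (i + 1) (j + 1)) * f i j := by
      rw [ih] at a1
      linear_combination (-1 : ℝ) * a1 + a2
    exact mul_right_cancel₀ hp.ne' this

lemma frieze_reflect (hf : IsInfFrieze f) : IsInfFrieze (fun i j => f (-j) (-i)) := by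
  obtain ⟨h0, h1, hpos, hu⟩ := hf
  refine ⟨fun i => h0 _, fun i => ?_, fun i j h => hpos _ _ (by omega), fun i j h => ?_⟩
  · have := h1 (-(i + 1))
    rwa [show -(i + 1) + 1 = -i by ring] at this
  · have := hu (-(j + 1)) (-(i + 1)) (by omega)
    rw [show -(j + 1) + 1 = -j by ring, show -(i + 1) + 1 = -i by ring] at this
    simp only
    linarith

lemma type_reflect (hl : IsTypeLambda p f) : IsTypeLambda p (fun i j => f (-j) (-i)) := by
  intro i
  obtain ⟨n, hn, h⟩ := hl (-(i + 2))
  refine ⟨n, hn, ?_⟩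
  rw [← h]
  simp only
  congr 1
  ring

lemma frieze_HW (hp : 3 ≤ p) (hf : IsInfFrieze f) (hl : IsTypeLambda p f) (c : ℤ) (k : ℕ) :
    HW p (f (c - k) c) (f (c - k - 1) c) := by
  induction k with
  | zero =>
    have := hf.2.1 (c - 1)
    rw [sub_add_cancel] at this
    simp only [Nat.cast_zero, sub_zero]
    rw [hf.1, this]
    exact HW.e1
  | succ k ih =>
    obtain ⟨n, hn, h⟩ := hl (c - k - 2)
    have hr := frieze_rec hf (c - k - 1) c (by omega)
    have hpos := hf.2.2.1 (c - k - 2) c (by omega)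
    rw [show c - k - 1 - 1 = c - k - 2 by ring, show c - (k : ℤ) - 1 + 1 = c - k - 2 + 2 by ring,
      h, show c - (k : ℤ) - 2 + 2 = c - k by ring] at hr
    rw [show c - ((k + 1 : ℕ) : ℤ) - 1 = c - k - 2 by push_cast; ring,
      show c - ((k + 1 : ℕ) : ℤ) = c - k - 1 by push_cast; ring]
    rw [hr] at hpos ⊢
    exact (ih.flip hp n hpos.le).swap hp

lemma frieze_int (hp : 3 ≤ p) (hf : IsInfFrieze f) (hl : IsTypeLambda p f) (b c : ℤ)
    (hbc : b + 1 ≤ c) (h : f b c = 1) : ∃ m : ℤ, f (b + 1) c = m * lam p := by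
  have := frieze_HW hp hf hl c (c - b - 1).toNat
  rw [Int.toNat_of_nonneg (by omega), show c - (c - b - 1) = b + 1 by ring,
    show b + 1 - 1 = b by ring] at this
  exact this.int_mult hp h

lemma ptolemy_right (hf : IsInfFrieze f) (c c' : ℤ) (hc : c < c') (k : ℕ) :
    f (c - k - 1) c * f (c - k) c' - f (c - k - 1) c' * f (c - k) c = f c c' := by
  induction k with
  | zero =>
    have := hf.2.1 (c - 1)
    rw [sub_add_cancel] at this
    simp only [Nat.cast_zero, sub_zero]
    rw [hf.1, this]; ring
  | succ k ih =>
    have r1 := frieze_rec hf (c - k - 1) c (by omega)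
    have r2 := frieze_rec hf (c - k - 1) c' (by omega)
    rw [show c - (k : ℤ) - 1 + 1 = c - k by ring] at r1 r2
    rw [show c - ((k + 1 : ℕ) : ℤ) = c - k - 1 by push_cast; ring, r1, r2, ← ih]
    ring

lemma right_inj (hf : IsInfFrieze f) (b c c' : ℤ) (hbc : b + 1 ≤ c) (hc : c < c')
    (h : f b c = 1) (h' : f b c' = 1) : f (b + 1) c < f (b + 1) c' := by
  have := ptolemy_right hf c c' hc (c - b - 1).toNat
  rw [Int.toNat_of_nonneg (by omega), show c - (c - b - 1) = b + 1 by ring,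
    show b + 1 - 1 = b by ring, h, h'] at this
  have := hf.2.2.1 c c' (by omega)
  linarith

lemma ptolemy_cross (hf : IsInfFrieze f) (b c : ℤ) (hc : b + 1 ≤ c) (k : ℕ) :
    f (b - k) c = f (b - k) (b + 1) * f b c - f (b - k) b * f (b + 1) c ∧
    f (b - k - 1) c = f (b - k - 1) (b + 1) * f b c - f (b - k - 1) b * f (b + 1) c := by
  induction k with
  | zero =>
    have := hf.2.1 (b - 1)
    rw [sub_add_cancel] at this
    simp only [Nat.cast_zero, sub_zero]
    rw [hf.1, hf.2.1, this, frieze_rec hf b c hc]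
    constructor <;> ring
  | succ k ih =>
    rw [show b - ((k + 1 : ℕ) : ℤ) = b - k - 1 by push_cast; ring]
    refine ⟨ih.2, ?_⟩
    have r1 := frieze_rec hf (b - k - 1) c (by omega)
    have r2 := frieze_rec hf (b - k - 1) b (by omega)
    have r3 := frieze_rec hf (b - k - 1) (b + 1) (by omega)
    rw [show b - (k : ℤ) - 1 + 1 = b - k by ring] at r1 r2 r3
    rw [r1, r2, r3, ih.1, ih.2]
    ring

lemma cross_eq (hf : IsInfFrieze f) (d b c : ℤ) (hd : d + 1 ≤ b) (hc : b + 1 ≤ c)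
    (h : f d b = 1) (h' : f b c = 1) :
    f d c = f (b - 1) (b + 1) - f d (b - 1) - f (b + 1) c := by
  have h1 := (ptolemy_cross hf b c hc (b - d).toNat).1
  rw [Int.toNat_of_nonneg (by omega), show b - (b - d) = d by ring, h, h'] at h1
  have h2 := frieze_rec (frieze_reflect hf) (-b) (-d) (by omega)
  simp only [neg_neg, neg_sub, neg_add] at h2
  rw [sub_neg_eq_add, h, show (1 : ℤ) + b = b + 1 by ring, show b + (-1 : ℤ) = b - 1 by ring] at h2
  linarith

end frieze

/-- `f (b-1) (b+1) ≥ λ_p · (1 + N(b))`; equivalently, the defect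
`f (b-1) (b+1) - λ_p · (1 + N(b))` is a nonnegative integer multiple of `λ_p`. -/
theorem infFrieze_defect_nonneg (p : ℕ) (hp : 3 ≤ p) (f : ℤ → ℤ → ℝ)
    (hf : IsInfFrieze f) (hl : IsTypeLambda p f) (b : ℤ)
    (hFin₁ : ({j : ℤ | j ≤ b - 2 ∧ f j b = 1}).Finite)
    (hFin₂ : ({j : ℤ | b + 2 ≤ j ∧ f b j = 1}).Finite) :
    lam p * (1 + (numArcs f b : ℝ)) ≤ f (b - 1) (b + 1) ∧
    ∃ m : ℕ, f (b - 1) (b + 1) - lam p * (1 + (numArcs f b : ℝ)) = (m : ℝ) * lam p := by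
  have hlam : 0 < lam p := by linarith [lam_ge hp]
  obtain ⟨n, hn, hab⟩ := hl (b - 1)
  rw [show b - 1 + 2 = b + 1 by ring] at hab
  have hb1 : f b (b + 1) = 1 := hf.2.1 b
  have hb2 : f (b - 1) b = 1 := by
    have := hf.2.1 (b - 1)
    rwa [sub_add_cancel] at this
  suffices hN : numArcs f b + 1 ≤ n by
    obtain ⟨m, hm⟩ := Nat.exists_eq_add_of_le hN
    have e : f (b - 1) (b + 1) - lam p * (1 + (numArcs f b : ℝ)) = (m : ℝ) * lam p := by
      rw [hab, hm]; push_cast; ring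
    have : 0 ≤ (m : ℝ) * lam p := by positivity
    exact ⟨by linarith, m, e⟩
  -- the position functions
  set φ : ℤ → ℤ := fun c => ⌊f (b + 1) c / lam p⌋ with hφ
  set ψ : ℤ → ℤ := fun d => (n : ℤ) - ⌊f d (b - 1) / lam p⌋ with hψ
  have fl : ∀ (x : ℝ) (m : ℤ), x = m * lam p → x = (⌊x / lam p⌋ : ℤ) * lam p := by
    intro x m h
    have : x / lam p = m := by rw [h]; field_simp
    rw [this, Int.floor_intCast, h]
  have hφe : ∀ c, b + 2 ≤ c → f b c = 1 → f (b + 1) c = (φ c : ℤ) * lam p := by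
    intro c hc h
    obtain ⟨m, hm⟩ := frieze_int hp hf hl b c (by omega) h
    exact fl _ m hm
  have hψe : ∀ d, d ≤ b - 2 → f d b = 1 → f d (b - 1) = ((n : ℝ) - (ψ d : ℤ)) * lam p := by
    intro d hd h
    obtain ⟨m, hm⟩ := frieze_int hp (frieze_reflect hf) (type_reflect hl) (-b) (-d) (by omega)
      (by simpa using h)
    simp only [neg_neg, neg_add] at hm
    rw [show b + (-1 : ℤ) = b - 1 by ring] at hm
    have := fl _ m hm
    rw [hψ]
    push_cast
    rw [sub_sub_cancel]
    exact this
  have cmp : ∀ u v : ℤ, (u : ℝ) * lam p < v * lam p → u < v := by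
    intro u v h
    exact_mod_cast lt_of_mul_lt_mul_right h hlam.le
  have hφr : ∀ c, b + 2 ≤ c → f b c = 1 → 0 < φ c ∧ φ c < n := by
    intro c hc h
    have e := hφe c hc h
    have p1 := hf.2.2.1 (b + 1) c (by omega)
    have p2 := hf.2.2.1 (b - 1) c (by omega)
    rw [cross_eq hf (b - 1) b c (by omega) (by omega) hb2 h, hf.1, hab, e] at p2
    rw [e] at p1
    constructor
    · apply cmp; simpa using p1
    · apply cmp; push_cast; linarith
  have hψr : ∀ d, d ≤ b - 2 → f d b = 1 → 0 < ψ d ∧ ψ d < n := by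
    intro d hd h
    have e := hψe d hd h
    have p1 := hf.2.2.1 d (b - 1) (by omega)
    have p2 := hf.2.2.1 d (b + 1) (by omega)
    rw [cross_eq hf d b (b + 1) (by omega) (by omega) h hb1, hf.1, hab, e] at p2
    rw [e] at p1
    constructor
    · apply cmp; push_cast; linarith
    · apply cmp; push_cast; linarith
  have hlt : ∀ c d, b + 2 ≤ c → f b c = 1 → d ≤ b - 2 → f d b = 1 → φ c < ψ d := by
    intro c d hc h hd h'
    have p2 := hf.2.2.1 d c (by omega)
    rw [cross_eq hf d b c (by omega) (by omega) h' h, hab, hφe c hc h, hψe d hd h'] at p2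
    apply cmp; linarith
  have hφi : Set.InjOn φ {j : ℤ | b + 2 ≤ j ∧ f b j = 1} := by
    have key : ∀ c c', b + 2 ≤ c → f b c = 1 → f b c' = 1 → c < c' → φ c < φ c' := by
      intro c c' hc h h' hlt
      have := right_inj hf b c c' (by omega) hlt h h'
      rw [hφe c hc h, hφe c' (by omega) h'] at this
      exact cmp _ _ this
    rintro c ⟨hc, h⟩ c' ⟨hc', h'⟩ heq
    rcases lt_trichotomy c c' with hh | hh | hh
    · exact absurd heq (key c c' hc h h' hh).ne
    · exact hh
    · exact absurd heq (key c' c hc' h' h hh).ne'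
  have hψi : Set.InjOn ψ {j : ℤ | j ≤ b - 2 ∧ f j b = 1} := by
    have key : ∀ d d', d ≤ b - 2 → f d b = 1 → f d' b = 1 → d' < d → ψ d' < ψ d := by
      intro d d' hd h h' hlt
      have := right_inj (frieze_reflect hf) (-b) (-d) (-d') (by omega) (by omega)
        (by simpa using h) (by simpa using h')
      simp only [neg_neg, neg_add] at this
      rw [show b + (-1 : ℤ) = b - 1 by ring, hψe d hd h, hψe d' (by omega) h'] at this
      apply cmp; linarith
    rintro d ⟨hd, h⟩ d' ⟨hd', h'⟩ heq
    rcases lt_trichotomy d d' with hh | hh | hh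
    · exact absurd heq (key d' d hd' h' h hh).ne
    · exact hh
    · exact absurd heq (key d d' hd h h' hh).ne'
  unfold numArcs
  rw [← Set.ncard_image_of_injOn hφi, ← Set.ncard_image_of_injOn hψi,
    ← Set.ncard_union_eq ?_ (hFin₁.image _) (hFin₂.image _)]
  · have hsub : ψ '' {j : ℤ | j ≤ b - 2 ∧ f j b = 1} ∪ φ '' {j : ℤ | b + 2 ≤ j ∧ f b j = 1}
        ⊆ ((Finset.Ioo (0 : ℤ) n : Finset ℤ) : Set ℤ) := by
      rintro _ (⟨d, ⟨hd, h⟩, rfl⟩ | ⟨c, ⟨hc, h⟩, rfl⟩)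
      · simpa using hψr d hd h
      · simpa using hφr c hc h
    have := Set.ncard_le_ncard hsub (Finset.finite_toSet _)
    rw [Set.ncard_coe_finset, Int.card_Ioo] at this
    omega
  · rw [Set.disjoint_left]
    rintro _ ⟨d, ⟨hd, h⟩, rfl⟩ ⟨c, ⟨hc, h'⟩, heq⟩
    exact absurd heq (hlt c d hc h' hd h).ne
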